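/- Let λ > 0 be real with λ ≠ 1, A = !![1, 0; 0, λ] ∈ M_2(ℂ), H = (1/√2) • !![1, 1; 1, -1] the Hadamard matrix, e₀, e₁ the standard basis of ℂ², v₊ = (1/√2)(e₀+e₁), v₋ = (1/√2)(e₀−e₁), and for nonzero ψ let T(ψ) := (H ψ)(H ψ)ᴴ / ⟪H ψ, A (H ψ)⟫. Then the two ensembles have the same initial density matrix, (1/2) • e₀ e₀ᴴ + (1/2) • e₁ e₁ᴴ = (1/2) • v₊ v₊ᴴ + (1/2) • v₋ v₋ᴴ, but different updated density matrices: (1/2) • T(e₀) + (1/2) • T(e₁) ≠ (1/2) • T(v₊) + (1/2) • T(v₋). Hence the state-dependent renormalized update map fails convex linearity. -/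

import Mathlib

open Matrix

/-- The Hadamard matrix `(1/√2) • !![1,1;1,-1]`. -/
noncomputable def Had : Matrix (Fin 2) (Fin 2) ℂ :=
  (1 / ((Real.sqrt 2 : ℝ) : ℂ)) • !![1, 1; 1, -1]

/-- The metric `A = !![1,0;0,λ]`. -/
noncomputable def Amat (l : ℝ) : Matrix (Fin 2) (Fin 2) ℂ := !![1, 0; 0, (l : ℂ)]

/-- Normalization factor `N(ψ) = ⟪H ψ, A (H ψ)⟫`. -/
noncomputable def Nfac (l : ℝ) (ψ : Fin 2 → ℂ) : ℂ :=
  star (Had.mulVec ψ) ⬝ᵥ (Amat l).mulVec (Had.mulVec ψ)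

/-- The renormalized updated pure state `T(ψ) = (1/N(ψ)) • (H ψ)(H ψ)ᴴ`. -/
noncomputable def Tupd (l : ℝ) (ψ : Fin 2 → ℂ) : Matrix (Fin 2) (Fin 2) ℂ :=
  (1 / Nfac l ψ) • Matrix.vecMulVec (Had.mulVec ψ) (star (Had.mulVec ψ))

lemma inv_sqrt_two_mul_self :
    (1 / ((Real.sqrt 2 : ℝ) : ℂ)) * (1 / ((Real.sqrt 2 : ℝ) : ℂ)) = 1 / 2 := by
  rw [div_mul_div_comm, ← Complex.ofReal_mul, Real.mul_self_sqrt (by norm_num)]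
  norm_num

lemma star_inv_sqrt_two :
    star (1 / ((Real.sqrt 2 : ℝ) : ℂ)) = 1 / ((Real.sqrt 2 : ℝ) : ℂ) := by
  simp

lemma Had_mulVec (ψ : Fin 2 → ℂ) :
    Had.mulVec ψ = (1 / ((Real.sqrt 2 : ℝ) : ℂ)) • ![ψ 0 + ψ 1, ψ 0 - ψ 1] := by
  ext i
  fin_cases i <;> simp [Had, Matrix.mulVec, dotProduct, Fin.sum_univ_two] <;> ring

/-- The top-left entry of the renormalized update, in terms of the entries of the input. -/
lemma Tupd_apply_zero_zero (l : ℝ) (ψ : Fin 2 → ℂ) :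
    Tupd l ψ 0 0 = (ψ 0 + ψ 1) * star (ψ 0 + ψ 1) /
      ((ψ 0 + ψ 1) * star (ψ 0 + ψ 1) + l * ((ψ 0 - ψ 1) * star (ψ 0 - ψ 1))) := by
  have key (a b : ℂ) : star ((1 / ((Real.sqrt 2 : ℝ) : ℂ)) * a) *
      ((1 / ((Real.sqrt 2 : ℝ) : ℂ)) * b) = 1 / 2 * (b * star a) := by
    rw [star_mul, star_inv_sqrt_two, ← inv_sqrt_two_mul_self]
    ring
  have hN : Nfac l ψ = 1 / 2 * ((ψ 0 + ψ 1) * star (ψ 0 + ψ 1) +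
      l * ((ψ 0 - ψ 1) * star (ψ 0 - ψ 1))) := by
    have h0 := key (ψ 0 + ψ 1) (ψ 0 + ψ 1)
    have h1 := key (ψ 0 - ψ 1) (ψ 0 - ψ 1)
    rw [Nfac, Had_mulVec]
    simp only [Amat, Matrix.mulVec, dotProduct, Fin.sum_univ_two, Pi.star_apply, Pi.smul_apply,
      smul_eq_mul, Matrix.of_apply, Matrix.cons_val_zero, Matrix.cons_val_one]
    linear_combination h0 + l * h1
  have h0 := key (ψ 0 + ψ 1) (ψ 0 + ψ 1)
  rw [Tupd, hN, Had_mulVec]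
  simp only [Matrix.smul_apply, Matrix.vecMulVec_apply, Pi.star_apply, Pi.smul_apply,
    smul_eq_mul, Matrix.cons_val_zero]
  rw [mul_comm (_ * (ψ 0 + ψ 1)), h0, one_div_mul_eq_div,
    mul_div_mul_left _ _ (by norm_num : (1 / 2 : ℂ) ≠ 0)]

/-- For `λ > 0`, `λ ≠ 1`, the computational-basis and diagonal-basis ensembles have the
same initial density matrix but different renormalized updated density matrices: the
state-dependent renormalized update map fails convex linearity. -/
theorem stmt_12 (l : ℝ) (hl : 0 < l) (hl1 : l ≠ 1) :
    ((1 / 2 : ℂ) • Matrix.vecMulVec (![1, 0] : Fin 2 → ℂ) (star (![1, 0] : Fin 2 → ℂ)) +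
        (1 / 2 : ℂ) • Matrix.vecMulVec (![0, 1] : Fin 2 → ℂ) (star (![0, 1] : Fin 2 → ℂ)) =
      (1 / 2 : ℂ) • Matrix.vecMulVec ((1 / ((Real.sqrt 2 : ℝ) : ℂ)) • ((![1, 0] : Fin 2 → ℂ) + (![0, 1] : Fin 2 → ℂ)))
          (star ((1 / ((Real.sqrt 2 : ℝ) : ℂ)) • ((![1, 0] : Fin 2 → ℂ) + (![0, 1] : Fin 2 → ℂ)))) +
        (1 / 2 : ℂ) • Matrix.vecMulVec ((1 / ((Real.sqrt 2 : ℝ) : ℂ)) • ((![1, 0] : Fin 2 → ℂ) - (![0, 1] : Fin 2 → ℂ)))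
          (star ((1 / ((Real.sqrt 2 : ℝ) : ℂ)) • ((![1, 0] : Fin 2 → ℂ) - (![0, 1] : Fin 2 → ℂ))))) ∧
    ((1 / 2 : ℂ) • Tupd l (![1, 0] : Fin 2 → ℂ) + (1 / 2 : ℂ) • Tupd l (![0, 1] : Fin 2 → ℂ) ≠
      (1 / 2 : ℂ) • Tupd l ((1 / ((Real.sqrt 2 : ℝ) : ℂ)) • ((![1, 0] : Fin 2 → ℂ) + (![0, 1] : Fin 2 → ℂ))) +
        (1 / 2 : ℂ) • Tupd l ((1 / ((Real.sqrt 2 : ℝ) : ℂ)) • ((![1, 0] : Fin 2 → ℂ) - (![0, 1] : Fin 2 → ℂ)))) := by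
  have hs := inv_sqrt_two_mul_self
  have hstar := star_inv_sqrt_two
  set c : ℂ := 1 / ((Real.sqrt 2 : ℝ) : ℂ)
  have hc : c ≠ 0 := by
    rintro h
    norm_num [h] at hs
  refine ⟨?_, fun h => hl1 ?_⟩
  · rw [Complex.star_def] at hstar
    ext i j
    simp only [Matrix.add_apply, Matrix.smul_apply, Matrix.vecMulVec_apply]
    fin_cases i <;> fin_cases j <;> simp [hstar, hs, -one_div] <;> norm_num
  · have h00 := congrFun (congrFun h 0) 0
    simp only [Matrix.add_apply, Matrix.smul_apply, Tupd_apply_zero_zero] at h00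
    have hl' : (1 + l : ℂ) ≠ 0 := by
      exact_mod_cast (by positivity : (1 + l : ℝ) ≠ 0)
    have h2 : c + c ≠ 0 := by
      rw [← two_mul]
      exact mul_ne_zero two_ne_zero hc
    have h2s : (starRingEnd ℂ) c + (starRingEnd ℂ) c ≠ 0 := by
      rw [← two_mul]
      exact mul_ne_zero two_ne_zero ((map_ne_zero _).2 hc)
    simp [h2, h2s] at h00
    field_simp at h00
    have : (l : ℂ) = 1 := by linear_combination -h00
    exact_mod_cast this
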